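/- Let a ≤ b be real numbers. Then for every s ∈ ℂ with Re(s) > −(a+b)/2 one has ξ(s+b+1) ≠ 0 and |ξ(s+a)/ξ(s+b+1)| < 1, and for every s with Re(s) = −(a+b)/2 one has |ξ(s+a)| = |ξ(s+b+1)|. -/

import Mathlib

noncomputable section

/-- The entire Riemann xi function `ξ(s) = s (s-1) ζ̂(s)`, where
`ζ̂(s) = π^(-s/2) Γ(s/2) ζ(s)` is the completed Riemann zeta function (written in terms of
the entire function `Λ₀ = completedRiemannZeta₀` so that the removable singularities at
`s = 0, 1` are correctly filled in: `s(s-1)Λ(s) = s(s-1)Λ₀(s) + 1`). -/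
def xi (s : ℂ) : ℂ := s * (s - 1) * completedRiemannZeta₀ s + 1

lemma WeakFEPair.exists_norm_Λ₀_le {E : Type*} [NormedAddCommGroup E] [NormedSpace ℂ E]
    (P : WeakFEPair E) (A B : ℝ) :
    ∃ K : ℝ, ∀ s : ℂ, A ≤ s.re → s.re ≤ B → ‖P.Λ₀ s‖ ≤ K := by
  have hconv (σ : ℝ) : MeasureTheory.IntegrableOn
      (fun t : ℝ => t ^ (σ - 1) * ‖P.f_modif t‖) (Set.Ioi 0) := by
    have h := (P.isStrongFEPair_toStrongFEPair.hasMellin (σ : ℂ)).1.norm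
    refine MeasureTheory.IntegrableOn.congr_fun h (fun t ht => ?_) measurableSet_Ioi
    simp only [norm_smul, Complex.norm_cpow_eq_rpow_re_of_pos ht, Complex.sub_re,
      Complex.ofReal_re, Complex.one_re]
    rfl
  refine ⟨∫ t in Set.Ioi (0 : ℝ),
    (t ^ (A - 1) * ‖P.f_modif t‖ + t ^ (B - 1) * ‖P.f_modif t‖), fun s hA hB => ?_⟩
  refine MeasureTheory.norm_integral_le_of_norm_le ((hconv A).add (hconv B)) ?_
  refine (MeasureTheory.ae_restrict_iff' measurableSet_Ioi).mpr (.of_forall fun t ht => ?_)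
  have ht : 0 < t := ht
  rw [norm_smul, Complex.norm_cpow_eq_rpow_re_of_pos ht, ← add_mul, Complex.sub_re,
    Complex.one_re]
  refine mul_le_mul_of_nonneg_right ?_ (norm_nonneg _)
  rcases le_total t 1 with h | h
  · have := Real.rpow_le_rpow_of_exponent_ge ht h (sub_le_sub_right hA 1)
    have := Real.rpow_nonneg ht.le (B - 1)
    linarith
  · have := Real.rpow_le_rpow_of_exponent_le h (sub_le_sub_right hB 1)
    have := Real.rpow_nonneg ht.le (A - 1)
    linarith

lemma exists_norm_completedRiemannZeta₀_le (A B : ℝ) :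
    ∃ K : ℝ, ∀ s : ℂ, A ≤ s.re → s.re ≤ B → ‖completedRiemannZeta₀ s‖ ≤ K := by
  obtain ⟨K, hK⟩ := (HurwitzZeta.hurwitzEvenFEPair 0).exists_norm_Λ₀_le (A / 2) (B / 2)
  refine ⟨K / 2, fun s hA hB => ?_⟩
  have h2 : (s / 2).re = s.re / 2 := by simp
  have := hK (s / 2) (by linarith) (by linarith)
  rw [completedRiemannZeta₀, HurwitzZeta.completedHurwitzZetaEven₀, norm_div]
  rw [Complex.norm_two]
  linarith

lemma differentiable_xi : Differentiable ℂ xi := by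
  have := differentiable_completedZeta₀
  unfold xi
  fun_prop

lemma xi_one_sub (s : ℂ) : xi (1 - s) = xi s := by
  simp only [xi, completedRiemannZeta₀_one_sub]
  ring

lemma xi_eq_Gamma_mul_zeta {s : ℂ} (hs : 0 < s.re) (hs1 : s ≠ 1) :
    xi s = 2 * (s - 1) * Complex.Gamma (s / 2 + 1) * (Real.pi : ℂ) ^ (-s / 2) * riemannZeta s := by
  have hs0 : s ≠ 0 := by rintro rfl; simp at hs
  have hG := Complex.Gammaℝ_ne_zero_of_re_pos hs
  have h1 : 1 - s ≠ 0 := sub_ne_zero.mpr hs1.symm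
  have h2 := riemannZeta_def_of_ne_zero hs0
  rw [completedRiemannZeta_eq, eq_div_iff hG, Complex.Gammaℝ_def] at h2
  rw [Complex.Gamma_add_one _ (div_ne_zero hs0 two_ne_zero), xi]
  generalize (Real.pi : ℂ) ^ (-s / 2) = p at h2 ⊢
  field_simp at h2
  linear_combination h2

lemma xi_conj (s : ℂ) : xi ((starRingEnd ℂ) s) = (starRingEnd ℂ) (xi s) := by
  have key {s : ℂ} (hs : 0 < s.re) : xi ((starRingEnd ℂ) s) = (starRingEnd ℂ) (xi s) := by
    rcases eq_or_ne s 1 with rfl | h1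
    · simp [xi]
    have hp : ((Real.pi : ℂ) ^ (-(starRingEnd ℂ) s / 2)) =
        (starRingEnd ℂ) ((Real.pi : ℂ) ^ (-s / 2)) := by
      have h := Complex.cpow_conj (Real.pi : ℂ) (-s / 2) (by
        rw [Complex.arg_ofReal_of_nonneg Real.pi_pos.le]; exact Real.pi_pos.ne)
      simpa [map_ofNat] using h
    rw [xi_eq_Gamma_mul_zeta hs h1, xi_eq_Gamma_mul_zeta (by simpa using hs)
      (by simpa using (starRingEnd ℂ).injective.ne h1), riemannZeta_conj, hp]
    simp [← Complex.Gamma_conj, map_ofNat]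
  rcases lt_or_ge 0 s.re with h | h
  · exact key h
  · have := key (s := 1 - s) (by simp; linarith)
    rwa [map_sub, map_one, xi_one_sub, xi_one_sub] at this

lemma xi_ne_zero_of_one_le_re {s : ℂ} (hs : 1 ≤ s.re) : xi s ≠ 0 := by
  rcases eq_or_ne s 1 with rfl | h1
  · simp [xi]
  rw [xi_eq_Gamma_mul_zeta (by linarith) h1]
  have h2 : s - 1 ≠ 0 := sub_ne_zero.mpr h1
  have h3 : Complex.Gamma (s / 2 + 1) ≠ 0 :=
    Complex.Gamma_ne_zero_of_re_pos (by simp; linarith)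
  have h4 : (Real.pi : ℂ) ^ (-s / 2) ≠ 0 := by simp [Complex.cpow_eq_zero_iff, Real.pi_ne_zero]
  have h5 := riemannZeta_ne_zero_of_one_le_re hs
  simp [*]

open ArithmeticFunction in
lemma exists_norm_riemannZeta_le {σ : ℝ} (hσ : 1 < σ) :
    ∃ M : ℝ, 0 < M ∧ ∀ s : ℂ, σ ≤ s.re → ‖riemannZeta s‖ ≤ M ∧ M⁻¹ ≤ ‖riemannZeta s‖ := by
  have hsum : Summable fun n : ℕ => 1 / (n : ℝ) ^ σ := Real.summable_one_div_nat_rpow.mpr hσ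
  have bound (f : ℕ → ℂ) (hf : ∀ n, ‖f n‖ ≤ 1) (s : ℂ) (hs : σ ≤ s.re) :
      ‖LSeries f s‖ ≤ ∑' n : ℕ, 1 / (n : ℝ) ^ σ := by
    refine tsum_of_norm_bounded hsum.hasSum fun n => ?_
    rw [LSeries.norm_term_eq]
    split_ifs with hn
    · positivity
    · have : (1 : ℝ) ≤ n := by exact_mod_cast Nat.one_le_iff_ne_zero.mpr hn
      exact div_le_div₀ zero_le_one (hf n) (by positivity)
        (Real.rpow_le_rpow_of_exponent_le this hs)
  refine ⟨∑' n : ℕ, 1 / (n : ℝ) ^ σ, ?_, fun s hs => ?_⟩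
  · exact hsum.tsum_pos (fun n => by positivity) 1 (by simp)
  have hs1 : 1 < s.re := by linarith
  have h1 := LSeries_one_eq_riemannZeta hs1
  have h2 := LSeries_one_mul_Lseries_moebius hs1
  rw [h1] at h2
  have b1 := bound 1 (by simp) s hs
  rw [h1] at b1
  have b2 := bound (fun n => ((moebius n : ℤ) : ℂ)) (fun n => by
    rw [Complex.norm_intCast]; exact_mod_cast abs_moebius_le_one) s hs
  refine ⟨b1, ?_⟩
  rw [eq_inv_of_mul_eq_one_right h2, norm_inv] at b2
  exact inv_le_of_inv_le₀ (norm_pos_iff.mpr (riemannZeta_ne_zero_of_one_le_re hs1.le)) b2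

lemma Complex.norm_Gamma_mul_Gamma_le {u : ℂ} {v : ℝ} (hu : 1 ≤ u.re) (hv : 0 < v) :
    ‖Complex.Gamma u‖ * Real.Gamma (v + 1) ≤ ‖Complex.Gamma (u + v)‖ := by
  have hB : ‖Complex.betaIntegral u v‖ ≤ 1 / v := by
    have h1 : ∀ x ∈ Set.Ioc (0 : ℝ) 1,
        ‖(x : ℂ) ^ (u - 1) * (1 - (x : ℂ)) ^ ((v : ℂ) - 1)‖ ≤ (1 - x) ^ (v - 1) := by
      intro x hx
      rcases hx.2.eq_or_lt with rfl | hx1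
      · rcases eq_or_ne (v - 1) 0 with h | h
        · have h' : (v : ℂ) - 1 = 0 := by exact_mod_cast h
          simp [h, h']
        · have h' : (v : ℂ) - 1 ≠ 0 := by exact_mod_cast h
          simp [h, h']
      · have : (1 - (x : ℂ)) = ((1 - x : ℝ) : ℂ) := by push_cast; ring
        rw [norm_mul, this, Complex.norm_cpow_eq_rpow_re_of_pos hx.1,
          Complex.norm_cpow_eq_rpow_re_of_pos (by linarith)]
        simp only [Complex.sub_re, Complex.one_re, Complex.ofReal_re]
        refine mul_le_of_le_one_left (Real.rpow_nonneg (by linarith) _) ?_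
        exact Real.rpow_le_one hx.1.le hx.2 (by linarith)
    have hint : IntervalIntegrable (fun x : ℝ => (1 - x) ^ (v - 1)) MeasureTheory.volume 0 1 := by
      have := (intervalIntegral.intervalIntegrable_rpow' (a := 0) (b := 1) (r := v - 1)
        (by linarith)).comp_sub_left 1
      simpa using this.symm
    have hval : ∫ x in (0 : ℝ)..1, (1 - x) ^ (v - 1) = 1 / v := by
      rw [intervalIntegral.integral_comp_sub_left (fun x : ℝ => x ^ (v - 1)) 1,
        integral_rpow (Or.inl (by linarith))]
      simp [hv.ne']
    rw [← hval]
    exact intervalIntegral.norm_integral_le_of_norm_le zero_le_one (.of_forall h1) hint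
  have hΓ := congrArg norm (Complex.Gamma_mul_Gamma_eq_betaIntegral (s := u) (t := v)
    (by linarith) (by simpa using hv))
  rw [norm_mul, norm_mul, Complex.Gamma_ofReal, Complex.norm_real, Real.norm_eq_abs,
    abs_of_pos (Real.Gamma_pos_of_pos hv)] at hΓ
  rw [Real.Gamma_add_one hv.ne']
  calc _ = v * (‖Complex.Gamma u‖ * Real.Gamma v) := by ring
    _ = v * (‖Complex.Gamma (u + v)‖ * ‖Complex.betaIntegral u v‖) := by rw [hΓ]
    _ ≤ v * (‖Complex.Gamma (u + v)‖ * (1 / v)) := by gcongr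
    _ = _ := by field_simp

lemma Complex.exp_neg_le_norm_Gamma (t : ℝ) :
    Real.exp (-(Real.pi * |t|)) ≤ 4 * ‖Complex.Gamma (3 / 2 + t * Complex.I)‖ ^ 2 := by
  set z : ℂ := 1 / 2 + t * Complex.I with hz
  have hz0 : z ≠ 0 := by intro h; simpa [hz] using congrArg Complex.re h
  have h1 : (3 / 2 : ℂ) + t * Complex.I = z + 1 := by rw [hz]; ring
  have h2 : 1 - z = (starRingEnd ℂ) z := by
    apply Complex.ext <;> simp [hz]; norm_num
  have h3 := congrArg norm (Complex.Gamma_mul_Gamma_one_sub z)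
  have h4 : Complex.sin (Real.pi * z) = Complex.cosh ((Real.pi * t : ℝ) : ℂ) := by
    rw [← Complex.cos_mul_I, ← Complex.sin_pi_div_two_sub, ← Complex.sin_pi_sub]
    congr 1
    rw [hz]; push_cast; ring
  rw [h2, Complex.Gamma_conj, norm_mul, RCLike.norm_conj, norm_div, h4, ← Complex.ofReal_cosh,
    Complex.norm_real, Complex.norm_real, Real.norm_eq_abs, Real.norm_eq_abs,
    abs_of_pos Real.pi_pos, abs_of_pos (Real.cosh_pos _)] at h3
  have h5 : (1 / 2 : ℝ) ≤ ‖z‖ := by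
    have := Complex.abs_re_le_norm z
    simp only [hz] at this ⊢
    norm_num at this ⊢
    simpa using this
  have h6 : Real.cosh (Real.pi * t) ≤ Real.exp (Real.pi * |t|) := by
    rw [Real.cosh_eq]
    have a1 : Real.pi * t ≤ Real.pi * |t| := by gcongr; exact le_abs_self t
    have a2 : -(Real.pi * t) ≤ Real.pi * |t| := by
      rw [← mul_neg]; gcongr; exact neg_le_abs t
    have := Real.exp_le_exp.mpr a1
    have := Real.exp_le_exp.mpr a2
    linarith
  rw [h1, Complex.Gamma_add_one _ hz0, norm_mul, mul_pow, sq ‖Complex.Gamma z‖, h3]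
  have h7 : (1 / 4 : ℝ) ≤ ‖z‖ ^ 2 := by nlinarith
  calc Real.exp (-(Real.pi * |t|)) = 1 / Real.exp (Real.pi * |t|) := by
        rw [Real.exp_neg, one_div]
    _ ≤ Real.pi / Real.cosh (Real.pi * t) :=
        div_le_div₀ Real.pi_pos.le (by linarith [Real.pi_gt_three]) (Real.cosh_pos _) h6
    _ ≤ 4 * (‖z‖ ^ 2 * (Real.pi / Real.cosh (Real.pi * t))) := by
        have : 0 < Real.pi / Real.cosh (Real.pi * t) := div_pos Real.pi_pos (Real.cosh_pos _)
        nlinarith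

lemma exists_norm_xi_le (A B : ℝ) :
    ∃ K : ℝ, 0 < K ∧ ∀ s : ℂ, A ≤ s.re → s.re ≤ B → ‖xi s‖ ≤ K * (1 + ‖s‖) ^ 2 := by
  obtain ⟨K, hK⟩ := exists_norm_completedRiemannZeta₀_le A B
  refine ⟨|K| + 1, by positivity, fun s hA hB => ?_⟩
  have h1 : ‖s - 1‖ ≤ 1 + ‖s‖ := by
    simpa [add_comm] using norm_sub_le s 1
  have h0 := norm_nonneg s
  calc ‖xi s‖ ≤ ‖s‖ * ‖s - 1‖ * ‖completedRiemannZeta₀ s‖ + 1 := by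
        refine (norm_add_le _ _).trans ?_
        simp
    _ ≤ (1 + ‖s‖) * (1 + ‖s‖) * |K| + 1 := by
        have := (hK s hA hB).trans (le_abs_self K)
        gcongr
        linarith
    _ ≤ _ := by nlinarith

lemma norm_xi_eq {s : ℂ} (hs : 1 < s.re) :
    ‖xi s‖ = 2 * ‖s - 1‖ * ‖Complex.Gamma (s / 2 + 1)‖ * Real.pi ^ (-(s.re / 2)) *
      ‖riemannZeta s‖ := by
  have h1 : s ≠ 1 := by rintro rfl; simp at hs
  rw [xi_eq_Gamma_mul_zeta (by linarith) h1]
  simp only [norm_mul, Complex.norm_two, Complex.norm_cpow_eq_rpow_re_of_pos Real.pi_pos]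
  congr 3
  simp [neg_div]

lemma exists_le_norm_xi {σ : ℝ} (hσ : 1 < σ) (R : ℝ) :
    ∃ δ : ℝ, 0 < δ ∧ ∀ s : ℂ, σ ≤ s.re → s.re ≤ R →
      δ * Real.exp (-(Real.pi * |s.im|)) ≤ ‖xi s‖ := by
  obtain ⟨M, hM, hζ⟩ := exists_norm_riemannZeta_le hσ
  obtain ⟨m, hm, hmΓ⟩ : ∃ m : ℝ, 0 < m ∧ ∀ v ∈ Set.Icc (0 : ℝ) |R|, m ≤ Real.Gamma (v + 1) := by
    have hcont : ContinuousOn (fun v : ℝ => Real.Gamma (v + 1)) (Set.Icc 0 |R|) := fun v hv =>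
      ((Real.differentiableAt_Gamma (s := v + 1) fun m => by
        have := hv.1
        have : (0 : ℝ) ≤ m := m.cast_nonneg
        exact (by linarith : -(m : ℝ) < v + 1).ne').continuousAt.comp (f := fun v : ℝ => v + 1)
          (by fun_prop)).continuousWithinAt
    obtain ⟨v, hv, hmin⟩ := isCompact_Icc.exists_isMinOn
      (Set.nonempty_Icc.mpr (abs_nonneg R)) hcont
    exact ⟨_, Real.Gamma_pos_of_pos (by linarith [hv.1]), fun w hw => hmin hw⟩
  refine ⟨2 * (σ - 1) * (1 / 2 * m) * Real.pi ^ (-(R / 2)) * M⁻¹,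
    by have := sub_pos.mpr hσ; positivity, fun s hs hR => ?_⟩
  have h1 : σ - 1 ≤ ‖s - 1‖ := by
    have := Complex.re_le_norm (s - 1)
    simp only [Complex.sub_re, Complex.one_re] at this
    linarith
  have hv : 0 < s.re / 2 - 1 / 2 := by linarith
  have h2 : 1 / 2 * m * Real.exp (-(Real.pi * |s.im|)) ≤ ‖Complex.Gamma (s / 2 + 1)‖ := by
    have hu := Complex.norm_Gamma_mul_Gamma_le (u := 3 / 2 + (s.im / 2 : ℝ) * Complex.I)
      (v := s.re / 2 - 1 / 2) (by simp; norm_num) hv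
    have he := Complex.exp_neg_le_norm_Gamma (s.im / 2)
    have hs' : (3 / 2 + (s.im / 2 : ℝ) * Complex.I + (s.re / 2 - 1 / 2 : ℝ) : ℂ) = s / 2 + 1 := by
      apply Complex.ext <;> simp
      ring
    rw [hs'] at hu
    have hm' := hmΓ (s.re / 2 - 1 / 2) ⟨hv.le, by linarith [le_abs_self R]⟩
    have hexp : Real.exp (-(Real.pi * |s.im|)) =
        Real.exp (-(Real.pi * |s.im / 2|)) ^ 2 := by
      rw [← Real.exp_nat_mul, abs_div, abs_two]
      congr 1; push_cast; ring
    have hle' : Real.exp (-(Real.pi * |s.im|)) ≤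
        2 * ‖Complex.Gamma (3 / 2 + (s.im / 2 : ℝ) * Complex.I)‖ := by
      refine le_of_sq_le_sq ?_ (by positivity)
      have hle2 : Real.exp (-(Real.pi * |s.im / 2|)) ≤ 1 := by
        rw [Real.exp_le_one_iff]; have := Real.pi_pos; have := abs_nonneg (s.im / 2); nlinarith
      have h0 := Real.exp_pos (-(Real.pi * |s.im / 2|))
      rw [hexp]
      nlinarith [pow_le_one₀ h0.le hle2 (n := 3), mul_le_mul_of_nonneg_left
        (pow_le_one₀ h0.le hle2 (n := 3)) h0.le]
    calc _ = 1 / 2 * Real.exp (-(Real.pi * |s.im|)) * m := by ring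
      _ ≤ ‖Complex.Gamma (3 / 2 + (s.im / 2 : ℝ) * Complex.I)‖ *
          Real.Gamma (s.re / 2 - 1 / 2 + 1) := by
        gcongr
        linarith
      _ ≤ _ := hu
  have h3 : Real.pi ^ (-(R / 2)) ≤ Real.pi ^ (-(s.re / 2)) :=
    Real.rpow_le_rpow_of_exponent_le (by linarith [Real.pi_gt_three]) (by linarith)
  rw [norm_xi_eq (by linarith)]
  calc _ = 2 * (σ - 1) * (1 / 2 * m * Real.exp (-(Real.pi * |s.im|))) *
        Real.pi ^ (-(R / 2)) * M⁻¹ := by ring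
    _ ≤ _ := by
      have := (hζ s hs).2
      have := sub_pos.mpr hσ
      gcongr

lemma exists_norm_xi_mul_Gamma_le :
    ∃ M : ℝ, 0 < M ∧ ∀ (s : ℂ) (v : ℝ), 2 ≤ s.re → 0 < v →
      ‖xi s‖ * Real.Gamma (v + 1) ≤ M * Real.pi ^ v * ‖xi (s + 2 * v)‖ := by
  obtain ⟨M, hM, hζ⟩ := exists_norm_riemannZeta_le one_lt_two
  refine ⟨M * M, by positivity, fun s v hs hv => ?_⟩
  have hre : (s + 2 * v).re = s.re + 2 * v := by simp
  have h1 : ‖s - 1‖ ≤ ‖s + 2 * v - 1‖ := by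
    rw [← sq_le_sq₀ (norm_nonneg _) (norm_nonneg _), Complex.sq_norm, Complex.sq_norm,
      Complex.normSq_apply, Complex.normSq_apply]
    simp
    nlinarith
  have h2 := Complex.norm_Gamma_mul_Gamma_le (u := s / 2 + 1) (v := v) (by simp; linarith) hv
  have h2' : s / 2 + 1 + v = (s + 2 * v) / 2 + 1 := by ring
  rw [h2'] at h2
  have h3 : Real.pi ^ (-(s.re / 2)) = Real.pi ^ v * Real.pi ^ (-((s.re + 2 * v) / 2)) := by
    rw [← Real.rpow_add Real.pi_pos]; congr 1; ring
  have h4 := (hζ s hs).1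
  have h5 : 1 ≤ M * ‖riemannZeta (s + 2 * v)‖ := by
    have := (hζ (s + 2 * v) (by rw [hre]; linarith)).2
    rwa [inv_le_iff_one_le_mul₀' hM] at this
  have hΓ : 0 < Real.Gamma (v + 1) := Real.Gamma_pos_of_pos (by linarith)
  rw [norm_xi_eq (by linarith), norm_xi_eq (by rw [hre]; linarith), hre, h3]
  calc _ = 2 * ‖s - 1‖ * (‖Complex.Gamma (s / 2 + 1)‖ * Real.Gamma (v + 1)) *
        (Real.pi ^ v * Real.pi ^ (-((s.re + 2 * v) / 2))) * ‖riemannZeta s‖ := by ring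
    _ ≤ 2 * ‖s + 2 * v - 1‖ * ‖Complex.Gamma ((s + 2 * v) / 2 + 1)‖ *
        (Real.pi ^ v * Real.pi ^ (-((s.re + 2 * v) / 2))) * M := by gcongr
    _ ≤ 2 * ‖s + 2 * v - 1‖ * ‖Complex.Gamma ((s + 2 * v) / 2 + 1)‖ *
        (Real.pi ^ v * Real.pi ^ (-((s.re + 2 * v) / 2))) * M *
        (M * ‖riemannZeta (s + 2 * v)‖) := le_mul_of_one_le_right (by positivity) h5
    _ = _ := by ring

lemma norm_xi_sub_eq_of_re_eq_zero (c : ℝ) {w : ℂ} (hw : w.re = 0) :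
    ‖xi (w - c)‖ = ‖xi (w + c + 1)‖ := by
  have h : 1 - (w - c) = (starRingEnd ℂ) (w + c + 1) := by
    apply Complex.ext <;> simp [hw]; ring
  rw [← xi_one_sub, h, xi_conj, RCLike.norm_conj]

lemma norm_xi_sub_le_of_pos {c : ℝ} (hc : 0 < c) {w : ℂ} (hw : 0 ≤ w.re) :
    ‖xi (w - c)‖ ≤ ‖xi (w + c + 1)‖ := by
  have hre (z : ℂ) : (z + c + 1).re = z.re + c + 1 := by simp
  have hne {z : ℂ} (hz : 0 ≤ z.re) : xi (z + c + 1) ≠ 0 :=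
    xi_ne_zero_of_one_le_re (by rw [hre]; linarith)
  have hd := differentiable_xi
  suffices h : ‖xi (w - c) / xi (w + c + 1)‖ ≤ 1 by
    rwa [norm_div, div_le_one (norm_pos_iff.mpr (hne hw))] at h
  obtain ⟨N, hNpos, hN⟩ : ∃ N : ℝ, 0 < N ∧ ∀ z : ℂ, c + 2 ≤ z.re →
      ‖xi (z - c) / xi (z + c + 1)‖ ≤ N := by
    obtain ⟨M, hM, h⟩ := exists_norm_xi_mul_Gamma_le
    have hΓ : 0 < Real.Gamma (c + 1 / 2 + 1) := Real.Gamma_pos_of_pos (by linarith)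
    refine ⟨M * Real.pi ^ (c + 1 / 2) / Real.Gamma (c + 1 / 2 + 1), by positivity,
      fun z hz => ?_⟩
    have h1 := h (z - c) (c + 1 / 2) (by simp; linarith) (by linarith)
    have h2 : z - c + 2 * (c + 1 / 2 : ℝ) = z + c + 1 := by push_cast; ring
    rw [h2] at h1
    rw [norm_div, div_le_div_iff₀ (norm_pos_iff.mpr (hne (by linarith))) hΓ]
    exact h1
  refine PhragmenLindelof.right_half_plane_of_bounded_on_real
    (f := fun z => xi (z - c) / xi (z + c + 1)) ?_ ?_ ?_ (fun y => ?_) hw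
  · refine DifferentiableOn.diffContOnCl ?_
    rw [Complex.closure_setOfPred_lt_re]
    exact fun z hz => ((by fun_prop : DifferentiableAt ℂ (fun z => xi (z - c)) z).div
      (by fun_prop) (hne hz)).differentiableWithinAt
  · obtain ⟨K, hK, hup⟩ := exists_norm_xi_le (-c) 2
    obtain ⟨δ, hδ, hlow⟩ := exists_le_norm_xi (σ := c + 1) (by linarith) (2 * c + 3)
    refine ⟨1, one_lt_two, 2 + Real.pi, .of_bound (N + K * Real.exp (c * 2) * δ⁻¹) ?_⟩
    refine Filter.eventually_inf_principal.mpr (.of_forall fun z (hz : 0 < z.re) => ?_)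
    have hpos : 0 ≤ (2 + Real.pi) * ‖z‖ ^ (1 : ℝ) := by positivity
    rw [Real.norm_of_nonneg (Real.exp_pos _).le]
    rcases le_total (c + 2) z.re with h | h
    · refine (hN z h).trans ?_
      have := Real.one_le_exp hpos
      nlinarith [show 0 < K * Real.exp (c * 2) * δ⁻¹ by positivity]
    · have h1 := hup (z - c) (by simp; linarith) (by simp; linarith)
      have h2 := hlow (z + c + 1) (by rw [hre]; linarith) (by rw [hre]; linarith)
      have h3 : (1 + ‖z - c‖) ^ 2 ≤ Real.exp (c * 2) * Real.exp (2 * ‖z‖) := by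
        have h4 : ‖z - c‖ ≤ ‖z‖ + c := by
          simpa [abs_of_pos hc] using norm_sub_le z (c : ℂ)
        have h5 : 1 + ‖z - c‖ ≤ Real.exp (‖z‖ + c) := by
          linarith [Real.add_one_le_exp (‖z‖ + c)]
        calc _ ≤ Real.exp (‖z‖ + c) ^ 2 := by gcongr
          _ = _ := by
            rw [← Real.exp_nat_mul, ← Real.exp_add]; congr 1; push_cast; ring
      have h6 : δ * Real.exp (-(Real.pi * ‖z‖)) ≤ ‖xi (z + c + 1)‖ := by
        refine le_trans ?_ h2
        have : |(z + c + 1).im| ≤ ‖z‖ := by simpa using Complex.abs_im_le_norm z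
        gcongr
      calc ‖xi (z - c) / xi (z + c + 1)‖
          ≤ (K * (Real.exp (c * 2) * Real.exp (2 * ‖z‖))) /
            (δ * Real.exp (-(Real.pi * ‖z‖))) := by
            rw [norm_div]
            refine div_le_div₀ (by positivity) (h1.trans ?_) (by positivity) h6
            gcongr
        _ = K * Real.exp (c * 2) * δ⁻¹ * Real.exp ((2 + Real.pi) * ‖z‖ ^ (1 : ℝ)) := by
            rw [Real.rpow_one, add_mul, Real.exp_add, Real.exp_neg]
            field_simp
        _ ≤ _ := by
            gcongr
            linarith
  · refine ⟨N, ?_⟩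
    rw [Filter.eventually_map]
    filter_upwards [Filter.eventually_ge_atTop (c + 2)] with x hx
    exact hN x (by simpa using hx)
  · have h0 : (y * Complex.I : ℂ).re = 0 := by simp
    rw [norm_div, norm_xi_sub_eq_of_re_eq_zero c h0,
      div_self (norm_ne_zero_iff.mpr (hne h0.ge))]

lemma norm_xi_sub_le {c : ℝ} (hc : 0 ≤ c) {w : ℂ} (hw : 0 ≤ w.re) :
    ‖xi (w - c)‖ ≤ ‖xi (w + c + 1)‖ := by
  have hcont := differentiable_xi.continuous
  refine ContinuousWithinAt.closure_le (s := Set.Ioi c)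
    (f := fun x : ℝ => ‖xi (w - x)‖) (g := fun x : ℝ => ‖xi (w + x + 1)‖) (by simp)
    (Continuous.continuousWithinAt (by fun_prop)) (Continuous.continuousWithinAt (by fun_prop))
    fun x hx => norm_xi_sub_le_of_pos (hc.trans_lt hx) hw

lemma Real.exists_mul_rpow_lt_Gamma_natCast_mul (C : ℝ) {T a : ℝ} (hT : 0 < T)
    (ha : 1 ≤ a) :
    ∃ n : ℕ, 0 < n ∧ C * a ^ (n * T) < Real.Gamma (n * T + 1) := by
  have hlim := FloorSemiring.tendsto_pow_div_factorial_atTop a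
  have hlim2 : Filter.Tendsto (fun n : ℕ => ⌊(n * T : ℝ)⌋₊) Filter.atTop Filter.atTop :=
    tendsto_nat_floor_atTop.comp (tendsto_natCast_atTop_atTop.atTop_mul_const hT)
  have h1 := (hlim.comp hlim2).eventually_lt_const
    (show (0 : ℝ) < 1 / ((|C| + 1) * a) by positivity)
  obtain ⟨n, hn, hn1, hn0⟩ := (h1.and ((hlim2.eventually_ge_atTop 1).and
    (Filter.eventually_gt_atTop 0))).exists
  refine ⟨n, hn0, ?_⟩
  set k := ⌊(n * T : ℝ)⌋₊
  have hk1 : (k : ℝ) ≤ n * T := Nat.floor_le (by positivity)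
  have hk2 : n * T < k + 1 := Nat.lt_floor_add_one _
  have hk3 : (1 : ℝ) ≤ k := by exact_mod_cast hn1
  have hΓ : (k.factorial : ℝ) ≤ Real.Gamma (n * T + 1) := by
    rw [← Real.Gamma_nat_eq_factorial]
    exact Real.Gamma_strictMonoOn_Ici.monotoneOn (by simp; linarith)
      (by simp; linarith) (by linarith)
  have hpow : a ^ (n * T) ≤ a ^ k * a := by
    rw [← pow_succ, ← Real.rpow_natCast]
    exact Real.rpow_le_rpow_of_exponent_le ha (by push_cast; linarith)
  have hfac : (0 : ℝ) < k.factorial := by positivity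
  simp only [Function.comp_apply] at hn
  rw [div_lt_div_iff₀ hfac (by positivity)] at hn
  calc C * a ^ (n * T) ≤ (|C| + 1) * (a ^ k * a) := by
        gcongr
        linarith [le_abs_self C]
    _ < k.factorial := by linarith
    _ ≤ _ := hΓ

lemma norm_xi_sub_lt {c : ℝ} (hc : 0 ≤ c) {w : ℂ} (hw : 0 < w.re) :
    ‖xi (w - c)‖ < ‖xi (w + c + 1)‖ := by
  have hne {z : ℂ} (hz : 0 < z.re) : xi (z + c + 1) ≠ 0 :=
    xi_ne_zero_of_one_le_re (by simp; linarith)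
  have hd := differentiable_xi
  refine (norm_xi_sub_le hc hw.le).lt_of_ne fun heq => ?_
  have hdiff : DifferentiableOn ℂ (fun z => xi (z - c) / xi (z + c + 1)) {z | 0 < z.re} :=
    fun z hz => ((by fun_prop : DifferentiableAt ℂ (fun z => xi (z - c)) z).div
      (by fun_prop) (hne hz)).differentiableWithinAt
  have hw1 : ‖xi (w - c) / xi (w + c + 1)‖ = 1 := by
    rw [norm_div, heq, div_self (norm_ne_zero_iff.mpr (hne hw))]
  have hconst := Complex.norm_eqOn_of_isPreconnected_of_isMaxOn
    (convex_halfSpace_re_gt 0).isPreconnected (isOpen_lt continuous_const Complex.continuous_re)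
    hdiff hw (fun z (hz : 0 < z.re) => by
      simp only [Set.mem_ofPred_eq, Function.comp_apply]
      rw [hw1, norm_div, div_le_one (norm_pos_iff.mpr (hne hz))]
      exact norm_xi_sub_le hc hz.le)
  have hshift (x : ℝ) (hx : 0 < x) : ‖xi x‖ = ‖xi (x + (2 * c + 1) : ℝ)‖ := by
    have h1 : 0 < ((x + c : ℝ) : ℂ).re := by simp; linarith
    have h := hconst h1
    simp only [Function.comp_apply, Function.const_apply] at h
    rw [hw1, norm_div, div_eq_one_iff_eq (norm_ne_zero_iff.mpr (hne h1))] at h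
    have h2 : ((x + c : ℝ) : ℂ) - c = x := by push_cast; ring
    have h3 : ((x + c : ℝ) : ℂ) + c + 1 = (x + (2 * c + 1) : ℝ) := by push_cast; ring
    rwa [h2, h3] at h
  have hper (n : ℕ) : ‖xi (2 : ℝ)‖ = ‖xi (2 + n * (2 * c + 1) : ℝ)‖ := by
    induction n with
    | zero => simp
    | succ n ih =>
      rw [ih, hshift _ (by positivity)]
      congr 3
      push_cast; ring
  obtain ⟨M, hM, h⟩ := exists_norm_xi_mul_Gamma_le
  obtain ⟨n, hn0, hn⟩ := Real.exists_mul_rpow_lt_Gamma_natCast_mul M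
    (T := c + 1 / 2) (a := Real.pi) (by linarith) (by linarith [Real.pi_gt_three])
  have h1 := h (2 : ℝ) (n * (c + 1 / 2)) (by simp) (by positivity)
  have h2 : ((2 : ℝ) : ℂ) + 2 * (n * (c + 1 / 2) : ℝ) = ((2 + n * (2 * c + 1) : ℝ) : ℂ) := by
    push_cast; ring
  rw [h2, ← hper n, mul_comm] at h1
  have h3 : 0 < ‖xi (2 : ℝ)‖ := norm_pos_iff.mpr (xi_ne_zero_of_one_le_re (by simp))
  exact absurd (le_of_mul_le_mul_right h1 h3) (not_le.mpr hn)

/-- Let `a ≤ b` be real. Then for `Re(s) > -(a+b)/2` one has `ξ(s+b+1) ≠ 0` and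
`|ξ(s+a)/ξ(s+b+1)| < 1`, while for `Re(s) = -(a+b)/2` one has `|ξ(s+a)| = |ξ(s+b+1)|`. -/
theorem xi_ratio_lt_one (a b : ℝ) (hab : a ≤ b) :
    (∀ s : ℂ, -((a + b) / 2) < s.re →
      xi (s + (b : ℂ) + 1) ≠ 0 ∧ ‖xi (s + (a : ℂ)) / xi (s + (b : ℂ) + 1)‖ < 1) ∧
    (∀ s : ℂ, s.re = -((a + b) / 2) →
      ‖xi (s + (a : ℂ))‖ = ‖xi (s + (b : ℂ) + 1)‖) := by
  have h1 (s : ℂ) : s + (a : ℂ) = s + ((a + b) / 2 : ℝ) - ((b - a) / 2 : ℝ) := by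
    push_cast; ring
  have h2 (s : ℂ) : s + (b : ℂ) + 1 = s + ((a + b) / 2 : ℝ) + ((b - a) / 2 : ℝ) + 1 := by
    push_cast; ring
  have hre (s : ℂ) : (s + ((a + b) / 2 : ℝ)).re = s.re + (a + b) / 2 := by
    rw [Complex.add_re, Complex.ofReal_re]
  refine ⟨fun s hs => ?_, fun s hs => ?_⟩
  · have hne : xi (s + (b : ℂ) + 1) ≠ 0 := xi_ne_zero_of_one_le_re (by simp; linarith)
    refine ⟨hne, ?_⟩
    rw [norm_div, div_lt_one (norm_pos_iff.mpr hne), h1, h2]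
    exact norm_xi_sub_lt (by linarith) (by rw [hre]; linarith)
  · rw [h1, h2]
    exact norm_xi_sub_eq_of_re_eq_zero _ (by rw [hre]; linarith)

end
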